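/- arXiv:math/0310164 — 4 statements merged into one kernel-verified Lean document; each statement's English description precedes it below -/
import Mathlib

section
/- With the data and eight identities of the algebraic monopole package, the map dto : Co ⊕ Cs → Co ⊕ Cs defined by dto(x,y) = (d_oo x + d_uo(db_su y), d_os x + db_ss y + dh_us(db_su y)) satisfies dto ∘ dto = 0. -/
section MonopolePackage

variable {Co Cs Cu : Type}
  [AddCommGroup Co] [AddCommGroup Cs] [AddCommGroup Cu]
  [Module (ZMod 2) Co] [Module (ZMod 2) Cs] [Module (ZMod 2) Cu]

/-- The differential `dto : Co ⊕ Cs → Co ⊕ Cs`,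
`dto(x,y) = (d_oo x + d_uo(db_su y), d_os x + db_ss y + dh_us(db_su y))`. -/
def dto (d_oo : Co →ₗ[ZMod 2] Co) (d_os : Co →ₗ[ZMod 2] Cs)
    (d_uo : Cu →ₗ[ZMod 2] Co) (dh_us : Cu →ₗ[ZMod 2] Cs)
    (db_ss : Cs →ₗ[ZMod 2] Cs) (db_su : Cs →ₗ[ZMod 2] Cu) :
    Co × Cs →ₗ[ZMod 2] Co × Cs :=
  LinearMap.prod
    (d_oo.comp (LinearMap.fst (ZMod 2) Co Cs) +
      (d_uo.comp db_su).comp (LinearMap.snd (ZMod 2) Co Cs))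
    (d_os.comp (LinearMap.fst (ZMod 2) Co Cs) +
      db_ss.comp (LinearMap.snd (ZMod 2) Co Cs) +
      (dh_us.comp db_su).comp (LinearMap.snd (ZMod 2) Co Cs))

/-- With the data and eight identities of the algebraic monopole package, the
differential `dto` squares to zero. -/
theorem stmt_7
    (d_oo : Co →ₗ[ZMod 2] Co) (d_os : Co →ₗ[ZMod 2] Cs)
    (d_uo : Cu →ₗ[ZMod 2] Co) (dh_us : Cu →ₗ[ZMod 2] Cs)
    (db_ss : Cs →ₗ[ZMod 2] Cs) (db_su : Cs →ₗ[ZMod 2] Cu)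
    (db_us : Cu →ₗ[ZMod 2] Cs) (db_uu : Cu →ₗ[ZMod 2] Cu)
    (h1 : d_oo.comp d_oo + (d_uo.comp db_su).comp d_os = 0)
    (h2 : d_os.comp d_oo + db_ss.comp d_os + (dh_us.comp db_su).comp d_os = 0)
    (h3 : d_oo.comp d_uo + d_uo.comp db_uu + d_uo.comp (db_su.comp dh_us) = 0)
    (h4 : db_us + d_os.comp d_uo + db_ss.comp dh_us + dh_us.comp db_uu
        + dh_us.comp (db_su.comp dh_us) = 0)
    (h5 : db_ss.comp db_ss + db_us.comp db_su = 0)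
    (h6 : db_ss.comp db_us + db_us.comp db_uu = 0)
    (h7 : db_uu.comp db_su + db_su.comp db_ss = 0)
    (h8 : db_uu.comp db_uu + db_su.comp db_us = 0) :
    (dto d_oo d_os d_uo dh_us db_ss db_su).comp
      (dto d_oo d_os d_uo dh_us db_ss db_su) = 0 := by
  have h3' (y : Cs) := LinearMap.congr_fun h3 (db_su y)
  have h4' (y : Cs) := LinearMap.congr_fun h4 (db_su y)
  have huo (y : Cs) := congrArg d_uo (LinearMap.congr_fun h7 y)
  have hus (y : Cs) := congrArg dh_us (LinearMap.congr_fun h7 y)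
  have h1' (x : Co) := LinearMap.congr_fun h1 x
  have h2' (x : Co) := LinearMap.congr_fun h2 x
  have h5' (y : Cs) := LinearMap.congr_fun h5 y
  simp only [LinearMap.add_apply, LinearMap.comp_apply, LinearMap.zero_apply, map_add,
    map_zero] at h1' h2' h3' h4' h5' huo hus
  refine LinearMap.ext fun ⟨x, y⟩ => Prod.ext ?_ ?_
  · simp only [dto, LinearMap.comp_apply, LinearMap.prod_apply, Function.prod, LinearMap.add_apply,
      LinearMap.fst_apply, LinearMap.snd_apply, map_add, LinearMap.zero_apply, Prod.fst_zero]
    linear_combination (norm := module) h1' x + h3' y + huo y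
      - ZModModule.add_self (d_uo (db_uu (db_su y)))
  · simp only [dto, LinearMap.comp_apply, LinearMap.prod_apply, Function.prod, LinearMap.add_apply,
      LinearMap.fst_apply, LinearMap.snd_apply, map_add, LinearMap.zero_apply, Prod.snd_zero]
    linear_combination (norm := module) h2' x + h4' y + h5' y + hus y
      - ZModModule.add_self (db_us (db_su y)) - ZModModule.add_self (dh_us (db_uu (db_su y)))

end MonopolePackage
end

section
/- With the data and eight identities of the algebraic monopole package, the map dfrom : Co ⊕ Cu → Co ⊕ Cu defined by dfrom(x,z) = (d_oo x + d_uo z, db_su(d_os x) + db_uu z + db_su(dh_us z)) satisfies dfrom ∘ dfrom = 0, and the map dred : Cs ⊕ Cu → Cs ⊕ Cu defined by dred(y,z) = (db_ss y + db_us z, db_su y + db_uu z) satisfies dred ∘ dred = 0. -/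
section MonopolePackage

variable {Co Cs Cu : Type}
  [AddCommGroup Co] [AddCommGroup Cs] [AddCommGroup Cu]
  [Module (ZMod 2) Co] [Module (ZMod 2) Cs] [Module (ZMod 2) Cu]

/-- The differential `dfrom : Co ⊕ Cu → Co ⊕ Cu`,
`dfrom(x,z) = (d_oo x + d_uo z, db_su(d_os x) + db_uu z + db_su(dh_us z))`. -/
def dfrom (d_oo : Co →ₗ[ZMod 2] Co) (d_os : Co →ₗ[ZMod 2] Cs)
    (d_uo : Cu →ₗ[ZMod 2] Co) (dh_us : Cu →ₗ[ZMod 2] Cs)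
    (db_su : Cs →ₗ[ZMod 2] Cu) (db_uu : Cu →ₗ[ZMod 2] Cu) :
    Co × Cu →ₗ[ZMod 2] Co × Cu :=
  LinearMap.prod
    (d_oo.comp (LinearMap.fst (ZMod 2) Co Cu) +
      d_uo.comp (LinearMap.snd (ZMod 2) Co Cu))
    ((db_su.comp d_os).comp (LinearMap.fst (ZMod 2) Co Cu) +
      db_uu.comp (LinearMap.snd (ZMod 2) Co Cu) +
      (db_su.comp dh_us).comp (LinearMap.snd (ZMod 2) Co Cu))

/-- The differential `dred : Cs ⊕ Cu → Cs ⊕ Cu`,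
`dred(y,z) = (db_ss y + db_us z, db_su y + db_uu z)`. -/
def dred (db_ss : Cs →ₗ[ZMod 2] Cs) (db_su : Cs →ₗ[ZMod 2] Cu)
    (db_us : Cu →ₗ[ZMod 2] Cs) (db_uu : Cu →ₗ[ZMod 2] Cu) :
    Cs × Cu →ₗ[ZMod 2] Cs × Cu :=
  LinearMap.prod
    (db_ss.comp (LinearMap.fst (ZMod 2) Cs Cu) +
      db_us.comp (LinearMap.snd (ZMod 2) Cs Cu))
    (db_su.comp (LinearMap.fst (ZMod 2) Cs Cu) +
      db_uu.comp (LinearMap.snd (ZMod 2) Cs Cu))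

/-- With the data and eight identities of the algebraic monopole package, the
differentials `dfrom` and `dred` square to zero. -/
theorem stmt_8
    (d_oo : Co →ₗ[ZMod 2] Co) (d_os : Co →ₗ[ZMod 2] Cs)
    (d_uo : Cu →ₗ[ZMod 2] Co) (dh_us : Cu →ₗ[ZMod 2] Cs)
    (db_ss : Cs →ₗ[ZMod 2] Cs) (db_su : Cs →ₗ[ZMod 2] Cu)
    (db_us : Cu →ₗ[ZMod 2] Cs) (db_uu : Cu →ₗ[ZMod 2] Cu)
    (h1 : d_oo.comp d_oo + (d_uo.comp db_su).comp d_os = 0)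
    (h2 : d_os.comp d_oo + db_ss.comp d_os + (dh_us.comp db_su).comp d_os = 0)
    (h3 : d_oo.comp d_uo + d_uo.comp db_uu + d_uo.comp (db_su.comp dh_us) = 0)
    (h4 : db_us + d_os.comp d_uo + db_ss.comp dh_us + dh_us.comp db_uu
        + dh_us.comp (db_su.comp dh_us) = 0)
    (h5 : db_ss.comp db_ss + db_us.comp db_su = 0)
    (h6 : db_ss.comp db_us + db_us.comp db_uu = 0)
    (h7 : db_uu.comp db_su + db_su.comp db_ss = 0)
    (h8 : db_uu.comp db_uu + db_su.comp db_us = 0) :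
    (dfrom d_oo d_os d_uo dh_us db_su db_uu).comp
      (dfrom d_oo d_os d_uo dh_us db_su db_uu) = 0 ∧
    (dred db_ss db_su db_us db_uu).comp (dred db_ss db_su db_us db_uu) = 0 := by
  have e1 : ∀ x, d_oo (d_oo x) + d_uo (db_su (d_os x)) = 0 := LinearMap.congr_fun h1
  have e2 (x : Co) := congrArg db_su (LinearMap.congr_fun h2 x)
  have e3 (z : Cu) := LinearMap.congr_fun h3 z
  have e4 (z : Cu) := congrArg db_su (LinearMap.congr_fun h4 z)
  have e5 : ∀ y, db_ss (db_ss y) + db_us (db_su y) = 0 := LinearMap.congr_fun h5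
  have e6 : ∀ z, db_ss (db_us z) + db_us (db_uu z) = 0 := LinearMap.congr_fun h6
  have e7 : ∀ y, db_uu (db_su y) + db_su (db_ss y) = 0 := LinearMap.congr_fun h7
  have e8 : ∀ z, db_uu (db_uu z) + db_su (db_us z) = 0 := LinearMap.congr_fun h8
  simp only [LinearMap.add_apply, LinearMap.comp_apply, LinearMap.zero_apply, map_add,
    map_zero] at e2 e3 e4
  constructor
  · refine LinearMap.ext fun ⟨x, z⟩ => Prod.ext ?_ ?_
    · simp only [dfrom, LinearMap.comp_apply, LinearMap.prod_apply, Function.prod,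
        LinearMap.add_apply, LinearMap.fst_apply, LinearMap.snd_apply, map_add,
        LinearMap.zero_apply, Prod.fst_zero]
      linear_combination (norm := module) e1 x + e3 z
    · simp only [dfrom, LinearMap.comp_apply, LinearMap.prod_apply, Function.prod,
        LinearMap.add_apply, LinearMap.fst_apply, LinearMap.snd_apply, map_add,
        LinearMap.zero_apply, Prod.snd_zero]
      linear_combination (norm := module) e2 x + e7 (d_os x) + e4 z + e7 (dh_us z) + e8 z
        - ZModModule.add_self (db_su (db_ss (d_os x)))
        - ZModModule.add_self (db_su (db_ss (dh_us z))) - ZModModule.add_self (db_su (db_us z))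
  · refine LinearMap.ext fun ⟨y, z⟩ => Prod.ext ?_ ?_
    · simp only [dred, LinearMap.comp_apply, LinearMap.prod_apply, Function.prod,
        LinearMap.add_apply, LinearMap.fst_apply, LinearMap.snd_apply, map_add,
        LinearMap.zero_apply, Prod.fst_zero]
      linear_combination (norm := module) e5 y + e6 z
    · simp only [dred, LinearMap.comp_apply, LinearMap.prod_apply, Function.prod,
        LinearMap.add_apply, LinearMap.fst_apply, LinearMap.snd_apply, map_add,
        LinearMap.zero_apply, Prod.snd_zero]
      linear_combination (norm := module) e7 y + e8 z

end MonopolePackage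
end

section
/- With the data and eight identities of the algebraic monopole package, define the linear maps i : Cs ⊕ Cu → Co ⊕ Cs by i(y,z) = (d_uo z, y + dh_us z), j : Co ⊕ Cs → Co ⊕ Cu by j(x,y) = (x, db_su y), and p : Co ⊕ Cu → Cs ⊕ Cu by p(x,z) = (d_os x + dh_us z, z). Then i, j, p are chain maps with respect to the differentials dred, dto, dfrom: i ∘ dred = dto ∘ i, j ∘ dto = dfrom ∘ j, and p ∘ dfrom = dred ∘ p. -/
section MonopolePackage

variable {Co Cs Cu : Type}
  [AddCommGroup Co] [AddCommGroup Cs] [AddCommGroup Cu]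
  [Module (ZMod 2) Co] [Module (ZMod 2) Cs] [Module (ZMod 2) Cu]

/-- The map `i(y,z) = (d_uo z, y + dh_us z) : Cs ⊕ Cu → Co ⊕ Cs`. -/
def iMap (d_uo : Cu →ₗ[ZMod 2] Co) (dh_us : Cu →ₗ[ZMod 2] Cs) :
    Cs × Cu →ₗ[ZMod 2] Co × Cs :=
  LinearMap.prod
    (d_uo.comp (LinearMap.snd (ZMod 2) Cs Cu))
    (LinearMap.fst (ZMod 2) Cs Cu + dh_us.comp (LinearMap.snd (ZMod 2) Cs Cu))

/-- The map `j(x,y) = (x, db_su y) : Co ⊕ Cs → Co ⊕ Cu`. -/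
def jMap (db_su : Cs →ₗ[ZMod 2] Cu) :
    Co × Cs →ₗ[ZMod 2] Co × Cu :=
  LinearMap.prod
    (LinearMap.fst (ZMod 2) Co Cs)
    (db_su.comp (LinearMap.snd (ZMod 2) Co Cs))

/-- The map `p(x,z) = (d_os x + dh_us z, z) : Co ⊕ Cu → Cs ⊕ Cu`. -/
def pMap (d_os : Co →ₗ[ZMod 2] Cs) (dh_us : Cu →ₗ[ZMod 2] Cs) :
    Co × Cu →ₗ[ZMod 2] Cs × Cu :=
  LinearMap.prod
    (d_os.comp (LinearMap.fst (ZMod 2) Co Cu) +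
      dh_us.comp (LinearMap.snd (ZMod 2) Co Cu))
    (LinearMap.snd (ZMod 2) Co Cu)

/-- With the data and eight identities of the algebraic monopole package, the maps
`i`, `j`, `p` are chain maps with respect to the differentials `dred`, `dto`, `dfrom`:
`i ∘ dred = dto ∘ i`, `j ∘ dto = dfrom ∘ j`, and `p ∘ dfrom = dred ∘ p`. -/
theorem stmt_9
    (d_oo : Co →ₗ[ZMod 2] Co) (d_os : Co →ₗ[ZMod 2] Cs)
    (d_uo : Cu →ₗ[ZMod 2] Co) (dh_us : Cu →ₗ[ZMod 2] Cs)
    (db_ss : Cs →ₗ[ZMod 2] Cs) (db_su : Cs →ₗ[ZMod 2] Cu)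
    (db_us : Cu →ₗ[ZMod 2] Cs) (db_uu : Cu →ₗ[ZMod 2] Cu)
    (h1 : d_oo.comp d_oo + (d_uo.comp db_su).comp d_os = 0)
    (h2 : d_os.comp d_oo + db_ss.comp d_os + (dh_us.comp db_su).comp d_os = 0)
    (h3 : d_oo.comp d_uo + d_uo.comp db_uu + d_uo.comp (db_su.comp dh_us) = 0)
    (h4 : db_us + d_os.comp d_uo + db_ss.comp dh_us + dh_us.comp db_uu
        + dh_us.comp (db_su.comp dh_us) = 0)
    (h5 : db_ss.comp db_ss + db_us.comp db_su = 0)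
    (h6 : db_ss.comp db_us + db_us.comp db_uu = 0)
    (h7 : db_uu.comp db_su + db_su.comp db_ss = 0)
    (h8 : db_uu.comp db_uu + db_su.comp db_us = 0) :
    (iMap d_uo dh_us).comp (dred db_ss db_su db_us db_uu) =
      (dto d_oo d_os d_uo dh_us db_ss db_su).comp (iMap d_uo dh_us) ∧
    (jMap db_su).comp (dto d_oo d_os d_uo dh_us db_ss db_su) =
      (dfrom d_oo d_os d_uo dh_us db_su db_uu).comp (jMap db_su) ∧
    (pMap d_os dh_us).comp (dfrom d_oo d_os d_uo dh_us db_su db_uu) =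
      (dred db_ss db_su db_us db_uu).comp (pMap d_os dh_us) := by
  have char_two : ∀ {M : Type} [AddCommGroup M] [Module (ZMod 2) M] {a b : M},
      a + b = 0 → a = b := fun {M _ _ a b} h => by
    rw [eq_neg_of_add_eq_zero_left h, ZModModule.neg_eq_self]
  have e2 (x : Co) : d_os (d_oo x) + dh_us (db_su (d_os x)) = db_ss (d_os x) := by
    apply char_two
    rw [add_right_comm]
    exact LinearMap.congr_fun h2 x
  have e3 (z : Cu) : d_uo (db_uu z) = d_oo (d_uo z) + d_uo (db_su (dh_us z)) := by
    apply char_two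
    rw [← add_assoc, add_comm (d_uo (db_uu z))]
    exact LinearMap.congr_fun h3 z
  have h4z (z : Cu) : db_us z + d_os (d_uo z) + db_ss (dh_us z) + dh_us (db_uu z) +
      dh_us (db_su (dh_us z)) = 0 := LinearMap.congr_fun h4 z
  have e4i (z : Cu) : db_us z + dh_us (db_uu z) =
      d_os (d_uo z) + db_ss (dh_us z) + dh_us (db_su (dh_us z)) := by
    apply char_two
    rw [← h4z z]
    abel
  have e4p (z : Cu) : d_os (d_uo z) + dh_us (db_uu z) + dh_us (db_su (dh_us z)) =
      db_ss (dh_us z) + db_us z := by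
    apply char_two
    rw [← h4z z]
    abel
  have e7 (y : Cs) : db_uu (db_su y) = db_su (db_ss y) :=
    char_two (LinearMap.congr_fun h7 y)
  refine ⟨LinearMap.ext fun ⟨y, z⟩ => ?_, LinearMap.ext fun ⟨x, y⟩ => ?_,
    LinearMap.ext fun ⟨x, z⟩ => ?_⟩
  · ext
    · simp only [iMap, dred, dto, LinearMap.comp_apply, LinearMap.prod_apply, Function.prod_apply,
        LinearMap.add_apply, LinearMap.fst_apply, LinearMap.snd_apply, map_add, e3]
      abel
    · simp only [iMap, dred, dto, LinearMap.comp_apply, LinearMap.prod_apply, Function.prod_apply,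
        LinearMap.add_apply, LinearMap.fst_apply, LinearMap.snd_apply, map_add]
      linear_combination (norm := abel) e4i z
  · ext
    · simp [jMap, dto, dfrom]
    · simp [jMap, dto, dfrom, e7]
  · ext
    · simp only [pMap, dred, dfrom, LinearMap.comp_apply, LinearMap.prod_apply, Function.prod_apply,
        LinearMap.add_apply, LinearMap.fst_apply, LinearMap.snd_apply, map_add]
      linear_combination (norm := abel) e2 x + e4p z
    · simp only [pMap, dred, dfrom, LinearMap.comp_apply, LinearMap.prod_apply, Function.prod_apply,
        LinearMap.add_apply, LinearMap.fst_apply, LinearMap.snd_apply, map_add]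
      abel

end MonopolePackage
end

section
/- With the data and eight identities of the algebraic monopole package, since dto, dfrom, dred all square to zero, their homologies H(dto) = ker(dto)/range(dto), H(dfrom) = ker(dfrom)/range(dfrom), H(dred) = ker(dred)/range(dred) are defined, and the chain maps i(y,z) = (d_uo z, y + dh_us z), j(x,y) = (x, db_su y), p(x,z) = (d_os x + dh_us z, z) induce maps i*, j*, p* on homology. The resulting triangle ⋯ → H(dred) →(i*) H(dto) →(j*) H(dfrom) →(p*) H(dred) →(i*) ⋯ is exact: range i* = ker j*, range j* = ker p*, and range p* = ker i*. -/
section Homology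

variable {A B C A' B' C' : Type}
  [AddCommGroup A] [AddCommGroup B] [AddCommGroup C]
  [AddCommGroup A'] [AddCommGroup B'] [AddCommGroup C']
  [Module (ZMod 2) A] [Module (ZMod 2) B] [Module (ZMod 2) C]
  [Module (ZMod 2) A'] [Module (ZMod 2) B'] [Module (ZMod 2) C']

/-- Homology of a two-step complex `A → B → C`: cycles in `B` modulo boundaries.
For a differential `d : M → M` with `d ∘ d = 0`, the homology `ker d / range d`
is `homologyOf d d`. -/
def homologyOf (dIn : A →ₗ[ZMod 2] B) (dOut : B →ₗ[ZMod 2] C) : Type :=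
  LinearMap.ker dOut ⧸ (LinearMap.range dIn).comap (LinearMap.ker dOut).subtype

instance (dIn : A →ₗ[ZMod 2] B) (dOut : B →ₗ[ZMod 2] C) :
    AddCommGroup (homologyOf dIn dOut) :=
  inferInstanceAs (AddCommGroup (LinearMap.ker dOut ⧸
    (LinearMap.range dIn).comap (LinearMap.ker dOut).subtype))

instance (dIn : A →ₗ[ZMod 2] B) (dOut : B →ₗ[ZMod 2] C) :
    Module (ZMod 2) (homologyOf dIn dOut) :=
  inferInstanceAs (Module (ZMod 2) (LinearMap.ker dOut ⧸
    (LinearMap.range dIn).comap (LinearMap.ker dOut).subtype))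

/-- The map induced on homology by a commuting square of chain maps. -/
def homologyMap (dIn : A →ₗ[ZMod 2] B) (dOut : B →ₗ[ZMod 2] C)
    (dIn' : A' →ₗ[ZMod 2] B') (dOut' : B' →ₗ[ZMod 2] C')
    (fA : A →ₗ[ZMod 2] A') (fB : B →ₗ[ZMod 2] B') (fC : C →ₗ[ZMod 2] C')
    (h1 : fB.comp dIn = dIn'.comp fA) (h2 : dOut'.comp fB = fC.comp dOut) :
    homologyOf dIn dOut →ₗ[ZMod 2] homologyOf dIn' dOut' :=
  Submodule.mapQ _ _
    (fB.restrict (p := LinearMap.ker dOut) (q := LinearMap.ker dOut')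
      (fun x hx => by
        have hx' : dOut x = 0 := hx
        have := LinearMap.ext_iff.mp h2 x
        simp only [LinearMap.comp_apply] at this
        simp only [LinearMap.mem_ker, this, hx', map_zero]))
    (by
      rintro ⟨x, hxker⟩ hx
      simp only [Submodule.mem_comap, Submodule.subtype_apply] at hx ⊢
      obtain ⟨a, ha⟩ := hx
      refine ⟨fA a, ?_⟩
      have := LinearMap.ext_iff.mp h1 a
      simp only [LinearMap.comp_apply] at this
      rw [LinearMap.restrict_apply]
      simp only [← this, ha])

end Homology

section MonopolePackage

variable {Co Cs Cu : Type}
  [AddCommGroup Co] [AddCommGroup Cs] [AddCommGroup Cu]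
  [Module (ZMod 2) Co] [Module (ZMod 2) Cs] [Module (ZMod 2) Cu]

/-- Elementwise criterion, in terms of cycles and boundaries, for exactness on homology. -/
theorem homologyMap_range_eq_ker {X Y Z : Type}
    [AddCommGroup X] [AddCommGroup Y] [AddCommGroup Z]
    [Module (ZMod 2) X] [Module (ZMod 2) Y] [Module (ZMod 2) Z]
    {dX : X →ₗ[ZMod 2] X} {dY : Y →ₗ[ZMod 2] Y} {dZ : Z →ₗ[ZMod 2] Z}
    {f : X →ₗ[ZMod 2] Y} {g : Y →ₗ[ZMod 2] Z}
    (hf : f.comp dX = dY.comp f) (hg : g.comp dY = dZ.comp g)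
    (hgf : ∀ x, dX x = 0 → ∃ w, dZ w = g (f x))
    (hlift : ∀ y w, dY y = 0 → dZ w = g y → ∃ x v, dX x = 0 ∧ dY v = f x - y) :
    LinearMap.range (homologyMap dX dX dY dY f f f hf hf.symm) =
      LinearMap.ker (homologyMap dY dY dZ dZ g g g hg hg.symm) := by
  apply le_antisymm
  · rintro _ ⟨q, rfl⟩
    obtain ⟨⟨x, hx⟩, rfl⟩ := Submodule.Quotient.mk_surjective _ q
    obtain ⟨w, hw⟩ := hgf x hx
    exact (Submodule.Quotient.mk_eq_zero _).mpr ⟨w, hw⟩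
  · intro q hq
    obtain ⟨⟨y, hy⟩, rfl⟩ := Submodule.Quotient.mk_surjective _ q
    obtain ⟨w, hw⟩ := (Submodule.Quotient.mk_eq_zero _).mp hq
    obtain ⟨x, v, hx, hv⟩ := hlift y w hy hw
    exact ⟨Submodule.Quotient.mk ⟨x, hx⟩, (Submodule.Quotient.eq _).mpr ⟨v, hv⟩⟩

/-- With the data and eight identities of the algebraic monopole package, the
differentials `dto`, `dfrom`, `dred` square to zero, their homologies are defined,
the chain maps `i`, `j`, `p` induce maps `i*`, `j*`, `p*` on homology, and the
resulting triangle `⋯ → H(dred) → H(dto) → H(dfrom) → H(dred) → ⋯` is exact: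
`range i* = ker j*`, `range j* = ker p*`, `range p* = ker i*`. -/
theorem stmt_10
    (d_oo : Co →ₗ[ZMod 2] Co) (d_os : Co →ₗ[ZMod 2] Cs)
    (d_uo : Cu →ₗ[ZMod 2] Co) (dh_us : Cu →ₗ[ZMod 2] Cs)
    (db_ss : Cs →ₗ[ZMod 2] Cs) (db_su : Cs →ₗ[ZMod 2] Cu)
    (db_us : Cu →ₗ[ZMod 2] Cs) (db_uu : Cu →ₗ[ZMod 2] Cu)
    (h1 : d_oo.comp d_oo + (d_uo.comp db_su).comp d_os = 0)
    (h2 : d_os.comp d_oo + db_ss.comp d_os + (dh_us.comp db_su).comp d_os = 0)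
    (h3 : d_oo.comp d_uo + d_uo.comp db_uu + d_uo.comp (db_su.comp dh_us) = 0)
    (h4 : db_us + d_os.comp d_uo + db_ss.comp dh_us + dh_us.comp db_uu
        + dh_us.comp (db_su.comp dh_us) = 0)
    (h5 : db_ss.comp db_ss + db_us.comp db_su = 0)
    (h6 : db_ss.comp db_us + db_us.comp db_uu = 0)
    (h7 : db_uu.comp db_su + db_su.comp db_ss = 0)
    (h8 : db_uu.comp db_uu + db_su.comp db_us = 0)
    -- the differentials square to zero (consequences of the eight identities):
    (hdto : (dto d_oo d_os d_uo dh_us db_ss db_su).comp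
      (dto d_oo d_os d_uo dh_us db_ss db_su) = 0)
    (hdfrom : (dfrom d_oo d_os d_uo dh_us db_su db_uu).comp
      (dfrom d_oo d_os d_uo dh_us db_su db_uu) = 0)
    (hdred : (dred db_ss db_su db_us db_uu).comp (dred db_ss db_su db_us db_uu) = 0)
    -- `i`, `j`, `p` are chain maps (consequences of the eight identities):
    (hi : (iMap d_uo dh_us).comp (dred db_ss db_su db_us db_uu) =
      (dto d_oo d_os d_uo dh_us db_ss db_su).comp (iMap d_uo dh_us))
    (hj : (jMap db_su).comp (dto d_oo d_os d_uo dh_us db_ss db_su) =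
      (dfrom d_oo d_os d_uo dh_us db_su db_uu).comp (jMap db_su))
    (hp : (pMap d_os dh_us).comp (dfrom d_oo d_os d_uo dh_us db_su db_uu) =
      (dred db_ss db_su db_us db_uu).comp (pMap d_os dh_us)) :
    LinearMap.range (homologyMap (dred db_ss db_su db_us db_uu)
        (dred db_ss db_su db_us db_uu) (dto d_oo d_os d_uo dh_us db_ss db_su)
        (dto d_oo d_os d_uo dh_us db_ss db_su)
        (iMap d_uo dh_us) (iMap d_uo dh_us) (iMap d_uo dh_us) hi hi.symm) =
      LinearMap.ker (homologyMap (dto d_oo d_os d_uo dh_us db_ss db_su)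
        (dto d_oo d_os d_uo dh_us db_ss db_su) (dfrom d_oo d_os d_uo dh_us db_su db_uu)
        (dfrom d_oo d_os d_uo dh_us db_su db_uu)
        (jMap db_su) (jMap db_su) (jMap db_su) hj hj.symm) ∧
    LinearMap.range (homologyMap (dto d_oo d_os d_uo dh_us db_ss db_su)
        (dto d_oo d_os d_uo dh_us db_ss db_su) (dfrom d_oo d_os d_uo dh_us db_su db_uu)
        (dfrom d_oo d_os d_uo dh_us db_su db_uu)
        (jMap db_su) (jMap db_su) (jMap db_su) hj hj.symm) =
      LinearMap.ker (homologyMap (dfrom d_oo d_os d_uo dh_us db_su db_uu)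
        (dfrom d_oo d_os d_uo dh_us db_su db_uu) (dred db_ss db_su db_us db_uu)
        (dred db_ss db_su db_us db_uu)
        (pMap d_os dh_us) (pMap d_os dh_us) (pMap d_os dh_us) hp hp.symm) ∧
    LinearMap.range (homologyMap (dfrom d_oo d_os d_uo dh_us db_su db_uu)
        (dfrom d_oo d_os d_uo dh_us db_su db_uu) (dred db_ss db_su db_us db_uu)
        (dred db_ss db_su db_us db_uu)
        (pMap d_os dh_us) (pMap d_os dh_us) (pMap d_os dh_us) hp hp.symm) =
      LinearMap.ker (homologyMap (dred db_ss db_su db_us db_uu)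
        (dred db_ss db_su db_us db_uu) (dto d_oo d_os d_uo dh_us db_ss db_su)
        (dto d_oo d_os d_uo dh_us db_ss db_su)
        (iMap d_uo dh_us) (iMap d_uo dh_us) (iMap d_uo dh_us) hi hi.symm) := by
  simp only [LinearMap.ext_iff, LinearMap.add_apply, LinearMap.comp_apply,
    LinearMap.zero_apply] at h2 h3 h4 h7
  refine ⟨homologyMap_range_eq_ker hi hj ?_ ?_, homologyMap_range_eq_ker hj hp ?_ ?_,
    homologyMap_range_eq_ker hp hi ?_ ?_⟩
  · rintro ⟨y, z⟩ h
    obtain ⟨-, hu⟩ := Prod.ext_iff.mp h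
    refine ⟨(0, z), Prod.ext ?_ ?_⟩ <;> simp [dred, dfrom, iMap, jMap] at hu ⊢
    linear_combination (norm := (match_scalars <;> rfl)) (1 : ZMod 2) • hu
  · rintro ⟨x, y⟩ ⟨a, c⟩ h h'
    obtain ⟨-, hs⟩ := Prod.ext_iff.mp h
    obtain ⟨ho, hu⟩ := Prod.ext_iff.mp h'
    refine ⟨(y + d_os a + dh_us c, c), (a, 0), Prod.ext ?_ ?_, Prod.ext ?_ ?_⟩ <;>
      simp [dred, dfrom, dto, iMap, jMap] at hs ho hu ⊢
    · have ho' := congrArg d_os ho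
      have hu' := congrArg dh_us hu
      simp only [map_add] at ho' hu'
      linear_combination (norm := (match_scalars <;> rfl))
        (1 : ZMod 2) • (hs + ho' + hu' + h2 a + h4 c)
    · linear_combination (norm := (match_scalars <;> rfl)) (1 : ZMod 2) • hu
    · linear_combination (norm := (match_scalars <;> rfl)) (1 : ZMod 2) • ho
    · linear_combination (norm := (match_scalars <;> rfl))
        -(1 : ZMod 2) • ZModModule.add_self (dh_us c)
  · rintro ⟨x, y⟩ h
    obtain ⟨-, hs⟩ := Prod.ext_iff.mp h
    refine ⟨(y, 0), Prod.ext ?_ ?_⟩ <;> simp [dred, dto, pMap, jMap] at hs ⊢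
    linear_combination (norm := (match_scalars <;> rfl)) (1 : ZMod 2) • hs
  · rintro ⟨x, z⟩ ⟨a, c⟩ h h'
    obtain ⟨ho, -⟩ := Prod.ext_iff.mp h
    obtain ⟨hs, hu⟩ := Prod.ext_iff.mp h'
    refine ⟨(x + d_uo c, a + dh_us c), (0, c), Prod.ext ?_ ?_, Prod.ext ?_ ?_⟩ <;>
      simp [dred, dfrom, dto, pMap, jMap] at ho hs hu ⊢
    · have hu' := congrArg d_uo hu
      simp only [map_add] at hu'
      linear_combination (norm := (match_scalars <;> rfl)) (1 : ZMod 2) • (ho + hu' + h3 c)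
    · have hu' := congrArg dh_us hu
      simp only [map_add] at hu'
      linear_combination (norm := (match_scalars <;> rfl)) (1 : ZMod 2) • (hs + hu' + h4 c)
    · linear_combination (norm := (match_scalars <;> rfl)) (1 : ZMod 2) • hu
  · rintro ⟨x, z⟩ h
    obtain ⟨ho, -⟩ := Prod.ext_iff.mp h
    refine ⟨(x, 0), Prod.ext ?_ ?_⟩ <;> simp [dfrom, dto, pMap, iMap] at ho ⊢
    · linear_combination (norm := (match_scalars <;> rfl)) (1 : ZMod 2) • ho
    · linear_combination (norm := (match_scalars <;> rfl))
        -(1 : ZMod 2) • ZModModule.add_self (dh_us z)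
  · rintro ⟨y, z⟩ ⟨a, c⟩ h h'
    obtain ⟨-, hu⟩ := Prod.ext_iff.mp h
    obtain ⟨ho, hs⟩ := Prod.ext_iff.mp h'
    refine ⟨(a, z + db_su c), (c, 0), Prod.ext ?_ ?_, Prod.ext ?_ ?_⟩ <;>
      simp [dred, dfrom, dto, pMap, iMap] at hu ho hs ⊢
    · linear_combination (norm := (match_scalars <;> rfl)) (1 : ZMod 2) • ho
    · have hs' := congrArg db_su hs
      simp only [map_add] at hs'
      linear_combination (norm := (match_scalars <;> rfl)) (1 : ZMod 2) • (hu + hs' + h7 c)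
    · linear_combination (norm := (match_scalars <;> rfl)) (1 : ZMod 2) • hs

end MonopolePackage
end
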